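/- Let B = (H_{i_1}, …, H_{i_r}) be a standard ordered base of 𝒜, with flag ξ(B) = (X_1 > ⋯ > X_r), X_p = ⋂_{k=p}^{r} H_{i_k}. Then the underlying set of B is an nbc-base if and only if H_{i_k} = min 𝒜_{X_k} for all 1 ≤ k ≤ r. -/

import Mathlib

open Module

noncomputable section

/-- An arrangement of `n` (affine) hyperplanes inside the ambient affine subspace `amb`
of the complex vector space `W`.  The linear order on the hyperplanes is the order of the
indices in `Fin n`; an arbitrary linear order is encoded by a permutation `σ` of `Fin n`,
with `i ≺ j ↔ σ i < σ j`. -/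
structure HArr (W : Type) [AddCommGroup W] [Module ℂ W] (n : ℕ) where
  amb : AffineSubspace ℂ W
  amb_ne : (amb : Set W).Nonempty
  H : Fin n → AffineSubspace ℂ W
  inj : Function.Injective H
  le_amb : ∀ i, H i ≤ amb
  nonemptyH : ∀ i, ((H i : Set W)).Nonempty
  hyp : ∀ i, finrank ℂ (H i).direction + 1 = finrank ℂ amb.direction

namespace HArr

variable {W : Type} [AddCommGroup W] [Module ℂ W] {n : ℕ}

/-- The intersection `⋂ S` of a subset of the arrangement (the ambient space for `S = ∅`). -/
def inter (A : HArr W n) (S : Finset (Fin n)) : AffineSubspace ℂ W :=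
  A.amb ⊓ S.inf A.H

/-- Codimension (inside the ambient space) of an affine subspace. -/
def cd (A : HArr W n) (X : AffineSubspace ℂ W) : ℕ :=
  finrank ℂ A.amb.direction - finrank ℂ X.direction

/-- A dependent subset of the arrangement. -/
def dep (A : HArr W n) (S : Finset (Fin n)) : Prop :=
  A.inter S ≠ ⊥ ∧ A.cd (A.inter S) < S.card

/-- An independent subset of the arrangement. -/
def indep (A : HArr W n) (S : Finset (Fin n)) : Prop :=
  A.inter S ≠ ⊥ ∧ A.cd (A.inter S) = S.card

/-- A base: a maximal independent subset. -/
def isBase (A : HArr W n) (S : Finset (Fin n)) : Prop :=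
  A.indep S ∧ ∀ T, A.indep T → S ⊆ T → S = T

open scoped Classical in
/-- The rank of a subarrangement `{H i : i ∈ C}`. -/
def rankOn (A : HArr W n) (C : Finset (Fin n)) : ℕ :=
  C.powerset.sup fun S => if A.indep S then S.card else 0

/-- The rank `r` of the arrangement. -/
def rank (A : HArr W n) : ℕ := A.rankOn Finset.univ

/-- A circuit: an inclusion-minimal dependent set. -/
def circuit (A : HArr W n) (S : Finset (Fin n)) : Prop :=
  A.dep S ∧ ∀ T ⊂ S, ¬ A.dep T

/-- A broken circuit w.r.t. the linear order given by `σ`. -/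
def brokenCircuit (A : HArr W n) (σ : Equiv.Perm (Fin n)) (S : Finset (Fin n)) : Prop :=
  ∃ i ∉ S, (∀ j ∈ S, σ i < σ j) ∧ A.circuit (insert i S)

/-- An nbc set: nonempty intersection and containing no broken circuit. -/
def nbcSet (A : HArr W n) (σ : Equiv.Perm (Fin n)) (S : Finset (Fin n)) : Prop :=
  A.inter S ≠ ⊥ ∧ ∀ T ⊆ S, ¬ A.brokenCircuit σ T

/-- An nbc-base. -/
def nbcBase (A : HArr W n) (σ : Equiv.Perm (Fin n)) (S : Finset (Fin n)) : Prop :=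
  A.nbcSet σ S ∧ A.isBase S

/-- A βnbc-base. -/
def betaNbcBase (A : HArr W n) (σ : Equiv.Perm (Fin n)) (S : Finset (Fin n)) : Prop :=
  A.nbcBase σ S ∧ ∀ i ∈ S, ∃ j, σ j < σ i ∧ A.isBase (insert j (S.erase i))

/-- Membership in the intersection poset `L(𝒜)`. -/
def memL (A : HArr W n) (X : AffineSubspace ℂ W) : Prop :=
  X ≠ ⊥ ∧ ∃ S : Finset (Fin n), A.inter S = X

/-- A maximal element of `L(𝒜)` (in the reverse-inclusion order). -/
def maximalL (A : HArr W n) (X : AffineSubspace ℂ W) : Prop :=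
  A.memL X ∧ ∀ Y, A.memL Y → Y ≤ X → Y = X

open scoped Classical in
/-- The set of indices of hyperplanes containing `X`, i.e. `𝒜_X`. -/
def sub (A : HArr W n) (X : AffineSubspace ℂ W) : Finset (Fin n) :=
  Finset.univ.filter fun i => X ≤ A.H i

/-- `X` is dense: `𝒜_X` admits no decomposition into two nonempty parts. -/
def denseL (A : HArr W n) (X : AffineSubspace ℂ W) : Prop :=
  ¬ ∃ S T : Finset (Fin n), Disjoint S T ∧ S.Nonempty ∧ T.Nonempty ∧
      S ∪ T = A.sub X ∧ A.cd (A.inter S) + A.cd (A.inter T) = A.cd X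

/-- `i` is the minimum of `S` w.r.t. the linear order given by `σ`. -/
def isMin (σ : Equiv.Perm (Fin n)) (i : Fin n) (S : Finset (Fin n)) : Prop :=
  i ∈ S ∧ ∀ j ∈ S, σ i ≤ σ j

/-- The standard ordered tuple of a finite set, w.r.t. the linear order given by `σ`:
`tup σ S p` is the element of `S` with `(p+1)`-st smallest `σ`-value. -/
def tup (σ : Equiv.Perm (Fin n)) (S : Finset (Fin n)) (p : Fin S.card) : Fin n :=
  σ.symm (((S.image ⇑σ).orderIsoOfFin (Finset.card_image_of_injective S σ.injective) p).1)

/-- The flag `ξ(B) = (X_1 > ⋯ > X_r)` of a standard ordered base: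
`flag σ S p = X_{p+1} = ⋂_{k ≥ p} H_{i_k}`. -/
def flag (A : HArr W n) (σ : Equiv.Perm (Fin n)) (S : Finset (Fin n)) (p : Fin S.card) :
    AffineSubspace ℂ W :=
  A.inter (S.filter fun i => σ (tup σ S p) ≤ σ i)

/-- Lexicographic order on standard ordered tuples (for the canonical order). -/
def lexLt (S T : Finset (Fin n)) : Prop :=
  List.Lex (· < ·) (S.sort (· ≤ ·)) (T.sort (· ≤ ·))

/-- `λ(X) = Σ_{H_i ∈ 𝒜_X} λ_i`. -/
def lamX (A : HArr W n) (lam : Fin n → ℂ) (X : AffineSubspace ℂ W) : ℂ :=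
  ∑ i ∈ A.sub X, lam i

/-- `X` is unmixed (w.r.t. the order `σ`). -/
def unmixedX (A : HArr W n) (σ : Equiv.Perm (Fin n)) (X : AffineSubspace ℂ W) : Prop :=
  (∀ S, A.nbcBase σ S → A.inter S = X → A.betaNbcBase σ S) ∨
  (∀ S, A.nbcBase σ S → A.inter S = X → ¬ A.betaNbcBase σ S)

/-- The linear order given by `σ` is unmixed. -/
def unmixedOrd (A : HArr W n) (σ : Equiv.Perm (Fin n)) : Prop :=
  ∀ X, A.maximalL X → A.unmixedX σ X

/-- Membership in the intersection poset of the deleted arrangement `𝒜 ∖ {H_{i₀}}`. -/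
def memLdel (A : HArr W n) (i₀ : Fin n) (X : AffineSubspace ℂ W) : Prop :=
  X ≠ ⊥ ∧ ∃ S : Finset (Fin n), i₀ ∉ S ∧ A.inter S = X

/-- A maximal element of the intersection poset of the deleted arrangement. -/
def maximalLdel (A : HArr W n) (i₀ : Fin n) (X : AffineSubspace ℂ W) : Prop :=
  A.memLdel i₀ X ∧ ∀ Y, A.memLdel i₀ Y → Y ≤ X → Y = X

/-- The generator `e_i` of the exterior algebra `E`. -/
def gen (i : Fin n) : ExteriorAlgebra ℂ (Fin n → ℂ) :=
  ExteriorAlgebra.ι ℂ (Pi.single i 1)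

/-- `e_S = e_{i_1} ∧ ⋯ ∧ e_{i_p}` for `S = {i_1 < ⋯ < i_p}`. -/
def eS (S : Finset (Fin n)) : ExteriorAlgebra ℂ (Fin n → ℂ) :=
  ((S.sort (· ≤ ·)).map gen).prod

/-- `∂e_S = Σ_k (−1)^{k−1} e_{S ∖ {i_k}}`. -/
def bdry (S : Finset (Fin n)) : ExteriorAlgebra ℂ (Fin n → ℂ) :=
  ∑ i ∈ S, ((-1 : ℂ) ^ (S.filter fun j => j < i).card) • eS (S.erase i)

/-- The defining relations of the Orlik–Solomon algebra. -/
inductive OSRel (A : HArr W n) :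
    ExteriorAlgebra ℂ (Fin n → ℂ) → ExteriorAlgebra ℂ (Fin n → ℂ) → Prop
  | isBot : ∀ S : Finset (Fin n), A.inter S = ⊥ → OSRel A (eS S) 0
  | isDep : ∀ S : Finset (Fin n), A.dep S → OSRel A (bdry S) 0

/-- The Orlik–Solomon algebra `A(𝒜)`: the exterior algebra modulo the ideal generated by
the `e_S` with empty intersection and the `∂e_S` with `S` dependent. -/
abbrev OS (A : HArr W n) := RingQuot (OSRel A)

/-- The quotient map `E → A(𝒜)`. -/
def osMk (A : HArr W n) : ExteriorAlgebra ℂ (Fin n → ℂ) →ₐ[ℂ] OS A :=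
  RingQuot.mkAlgHom ℂ (OSRel A)

/-- `ω_i`, the image of `e_i` in the Orlik–Solomon algebra. -/
def om (A : HArr W n) (i : Fin n) : OS A := osMk A (gen i)

/-- `ω_B`, the image of `e_B` in the Orlik–Solomon algebra. -/
def omB (A : HArr W n) (S : Finset (Fin n)) : OS A := osMk A (eS S)

/-- The degree `p` part `A^p` of the Orlik–Solomon algebra. -/
def deg (A : HArr W n) (p : ℕ) : Submodule ℂ (OS A) :=
  Submodule.span ℂ {x | ∃ S : Finset (Fin n), S.card = p ∧ x = omB A S}

/-- `ω_λ = Σ_i λ_i ω_i`. -/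
def omLam (A : HArr W n) (lam : Fin n → ℂ) : OS A := ∑ i, lam i • om A i

/-- `ω_λ(X) = Σ_{H_i ∈ 𝒜_X} λ_i ω_i`. -/
def omLamX (A : HArr W n) (lam : Fin n → ℂ) (X : AffineSubspace ℂ W) : OS A :=
  ∑ i ∈ A.sub X, lam i • om A i

/-- The form `Ξ(B) = ω_λ(X_1) ⋯ ω_λ(X_r)` attached to a standard ordered base. -/
def Xi (A : HArr W n) (σ : Equiv.Perm (Fin n)) (lam : Fin n → ℂ) (S : Finset (Fin n)) :
    OS A :=
  ((List.finRange S.card).map fun p => A.omLamX lam (A.flag σ S p)).prod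

/-- The submodule `ω_λ ∧ A^p` of the Orlik-Solomon algebra. -/
def Ideg (A : HArr W n) (lam : Fin n → ℂ) (p : ℕ) : Submodule ℂ (OS A) :=
  (A.deg p).map (LinearMap.mulLeft ℂ (A.omLam lam))

end HArr

namespace HArr

variable {W : Type} [AddCommGroup W] [Module ℂ W] {n : ℕ}

lemma tup_mem (σ : Equiv.Perm (Fin n)) (S : Finset (Fin n)) (p : Fin S.card) :
    tup σ S p ∈ S := by
  obtain ⟨x, hx, hxe⟩ := Finset.mem_image.mp
    ((S.image ⇑σ).orderIsoOfFin (Finset.card_image_of_injective S σ.injective) p).2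
  rw [tup, ← hxe, Equiv.symm_apply_apply]
  exact hx

lemma exists_tup_eq (σ : Equiv.Perm (Fin n)) {S : Finset (Fin n)} {i : Fin n} (hi : i ∈ S) :
    ∃ p, tup σ S p = i := by
  refine ⟨((S.image ⇑σ).orderIsoOfFin (Finset.card_image_of_injective S σ.injective)).symm
    ⟨σ i, Finset.mem_image_of_mem σ hi⟩, ?_⟩
  simp [tup]

lemma inter_insert (A : HArr W n) (i : Fin n) (S : Finset (Fin n)) :
    A.inter (insert i S) = A.inter S ⊓ A.H i := by
  simp only [inter, Finset.inf_insert]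
  rw [inf_comm (A.H i), inf_assoc]

lemma inter_empty (A : HArr W n) : A.inter ∅ = A.amb := by
  simp [inter]

lemma inter_le_amb (A : HArr W n) (S : Finset (Fin n)) : A.inter S ≤ A.amb :=
  inf_le_left

lemma inter_anti (A : HArr W n) {S T : Finset (Fin n)} (h : S ⊆ T) : A.inter T ≤ A.inter S :=
  inf_le_inf_left _ (Finset.inf_mono h)

lemma inter_le_H (A : HArr W n) {S : Finset (Fin n)} {i : Fin n} (h : i ∈ S) :
    A.inter S ≤ A.H i :=
  inf_le_right.trans (Finset.inf_le h)

lemma inter_ne_bot_of_subset (A : HArr W n) {S T : Finset (Fin n)} (h : S ⊆ T)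
    (hT : A.inter T ≠ ⊥) : A.inter S ≠ ⊥ :=
  fun hS => hT (le_bot_iff.mp (hS ▸ A.inter_anti h))

lemma mem_sub (A : HArr W n) {X : AffineSubspace ℂ W} {i : Fin n} :
    i ∈ A.sub X ↔ X ≤ A.H i := by
  simp [sub]

lemma exists_circuit_subset (A : HArr W n) {S : Finset (Fin n)} (hS : A.dep S) :
    ∃ C ⊆ S, A.circuit C := by
  induction S using Finset.strongInduction with
  | H S ih =>
    by_cases h : ∃ T ⊂ S, A.dep T
    · obtain ⟨T, hT, hd⟩ := h
      obtain ⟨C, hC, hc⟩ := ih T hT hd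
      exact ⟨C, hC.trans hT.subset, hc⟩
    · exact ⟨S, Finset.Subset.refl S, hS, fun T hT hd => h ⟨T, hT, hd⟩⟩

lemma not_dep_singleton (A : HArr W n) (i : Fin n) : ¬ A.dep {i} := by
  intro hd
  have hi := A.hyp i
  have hlt := hd.2
  rw [inter, Finset.inf_singleton, inf_eq_right.mpr (A.le_amb i), cd,
    Finset.card_singleton] at hlt
  omega

variable [FiniteDimensional ℂ W]

lemma finrank_direction_inter_le_amb (A : HArr W n) (S : Finset (Fin n)) :
    finrank ℂ (A.inter S).direction ≤ finrank ℂ A.amb.direction :=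
  Submodule.finrank_mono (AffineSubspace.direction_le (A.inter_le_amb S))

lemma cd_inter_insert_le (A : HArr W n) (i : Fin n) (S : Finset (Fin n))
    (h : A.inter (insert i S) ≠ ⊥) :
    A.cd (A.inter (insert i S)) ≤ A.cd (A.inter S) + 1 := by
  rw [inter_insert] at h ⊢
  obtain ⟨x, hx⟩ := (AffineSubspace.nonempty_iff_ne_bot _).mpr h
  have hdir := AffineSubspace.direction_inf_of_mem hx.1 hx.2
  have hsum := Submodule.finrank_sup_add_finrank_inf_eq (A.inter S).direction (A.H i).direction
  have hsup : finrank ℂ ↥((A.inter S).direction ⊔ (A.H i).direction) ≤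
      finrank ℂ A.amb.direction :=
    Submodule.finrank_mono (sup_le (AffineSubspace.direction_le (A.inter_le_amb S))
      (AffineSubspace.direction_le (A.le_amb i)))
  have hi := A.hyp i
  rw [cd, cd, hdir]
  omega

lemma cd_inter_union_le (A : HArr W n) (S T : Finset (Fin n)) (h : A.inter (S ∪ T) ≠ ⊥) :
    A.cd (A.inter (S ∪ T)) ≤ A.cd (A.inter S) + T.card := by
  induction T using Finset.induction_on with
  | empty => simp
  | insert i T hi ih =>
    rw [Finset.union_insert] at h ⊢
    have h1 := A.cd_inter_insert_le i (S ∪ T) h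
    have h2 := ih (A.inter_ne_bot_of_subset (Finset.subset_insert _ _) h)
    rw [Finset.card_insert_of_notMem hi]
    omega

lemma cd_inter_le_card (A : HArr W n) {S : Finset (Fin n)} (h : A.inter S ≠ ⊥) :
    A.cd (A.inter S) ≤ S.card := by
  have hcd := A.cd_inter_union_le ∅ S (by rwa [Finset.empty_union])
  rwa [Finset.empty_union, inter_empty, cd.eq_def A A.amb, Nat.sub_self, zero_add] at hcd

lemma not_dep_of_subset_indep (A : HArr W n) {S T : Finset (Fin n)} (hS : A.indep S)
    (hT : T ⊆ S) : ¬ A.dep T := by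
  intro hd
  have h := A.cd_inter_union_le T (S \ T) (by rw [Finset.union_sdiff_of_subset hT]; exact hS.1)
  rw [Finset.union_sdiff_of_subset hT, hS.2] at h
  have hc := Finset.card_sdiff_add_card_eq_card hT
  have := hd.2
  omega

/-- Adding a hyperplane to an independent set makes it dependent only if the hyperplane
contains the intersection. -/
lemma inter_le_H_of_dep_insert (A : HArr W n) {i : Fin n} {S : Finset (Fin n)}
    (hi : i ∉ S) (hd : A.dep (insert i S)) (hS : ¬ A.dep S) : A.inter S ≤ A.H i := by
  have hle := A.inter_anti (Finset.subset_insert i S)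
  have hne := A.inter_ne_bot_of_subset (Finset.subset_insert i S) hd.1
  have hcard : S.card ≤ A.cd (A.inter S) := not_lt.mp fun hlt => hS ⟨hne, hlt⟩
  have hlt := hd.2
  rw [Finset.card_insert_of_notMem hi] at hlt
  have hamb := A.finrank_direction_inter_le_amb S
  have hamb' := A.finrank_direction_inter_le_amb (insert i S)
  have hdir : (A.inter (insert i S)).direction = (A.inter S).direction := by
    refine Submodule.eq_of_le_of_finrank_le (AffineSubspace.direction_le hle) ?_
    simp only [cd] at hlt hcard
    omega
  have heq : A.inter (insert i S) = A.inter S :=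
    AffineSubspace.eq_of_direction_eq_of_nonempty_of_le hdir
      ((AffineSubspace.nonempty_iff_ne_bot _).mpr hd.1) hle
  exact heq ▸ A.inter_le_H (Finset.mem_insert_self i S)

/-- A hyperplane containing the intersection of a set, but not belonging to it, makes it
dependent. -/
lemma dep_insert_of_inter_le_H (A : HArr W n) {i : Fin n} {S : Finset (Fin n)}
    (hi : i ∉ S) (hne : A.inter S ≠ ⊥) (hle : A.inter S ≤ A.H i) : A.dep (insert i S) := by
  have hcd := A.cd_inter_le_card hne
  rw [dep, inter_insert, inf_eq_left.mpr hle, Finset.card_insert_of_notMem hi]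
  exact ⟨hne, by omega⟩

end HArr

open scoped Classical
/-- A standard ordered base `B = (H_{i_1}, …, H_{i_r})`, with flag
`ξ(B) = (X_1 > ⋯ > X_r)`, is an nbc-base iff `H_{i_k} = min 𝒜_{X_k}` for all `k`. -/
theorem nbcBase_iff_min_flag {W : Type} [AddCommGroup W] [Module ℂ W]
    [FiniteDimensional ℂ W] {n : ℕ} (A : HArr W n) (S : Finset (Fin n))
    (hS : A.isBase S) :
    A.nbcBase 1 S ↔
      ∀ p : Fin S.card, HArr.isMin 1 (HArr.tup 1 S p) (A.sub (A.flag 1 S p)) := by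
  constructor
  · rintro ⟨⟨hne, hnbc⟩, -⟩ p
    refine ⟨A.mem_sub.mpr (A.inter_le_H ?_), fun j hj => ?_⟩
    · exact Finset.mem_filter.mpr ⟨HArr.tup_mem 1 S p, le_rfl⟩
    · by_contra! hlt
      have hsub := A.mem_sub.mp hj
      rw [HArr.flag] at hsub
      set U := S.filter fun i => (1 : Equiv.Perm (Fin n)) (HArr.tup 1 S p) ≤
        (1 : Equiv.Perm (Fin n)) i
      have hUS : U ⊆ S := Finset.filter_subset _ _
      have hlt' : ∀ i ∈ U, j < i := fun i hi => hlt.trans_le (Finset.mem_filter.mp hi).2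
      have hjU : j ∉ U := fun h => lt_irrefl _ (hlt' j h)
      obtain ⟨C, hC, hcirc⟩ := A.exists_circuit_subset
        (A.dep_insert_of_inter_le_H hjU (A.inter_ne_bot_of_subset hUS hne) hsub)
      have hCU : C.erase j ⊆ U := Finset.subset_insert_iff.mp hC
      have hjC : j ∈ C := by
        by_contra hjC
        rw [Finset.erase_eq_of_notMem hjC] at hCU
        exact A.not_dep_of_subset_indep hS.1 (hCU.trans hUS) hcirc.1
      refine hnbc _ (hCU.trans hUS) ⟨j, Finset.notMem_erase j C, fun i hi => hlt' i (hCU hi), ?_⟩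
      rwa [Finset.insert_erase hjC]
  · intro hmin
    refine ⟨⟨hS.1.1, ?_⟩, hS⟩
    rintro T hT ⟨i, hiT, hlt, hcirc⟩
    have hTne : T.Nonempty := by
      rw [Finset.nonempty_iff_ne_empty]
      rintro rfl
      exact A.not_dep_singleton i hcirc.1
    obtain ⟨p, hp⟩ := HArr.exists_tup_eq 1 (hT (T.min'_mem hTne))
    have hle := A.inter_le_H_of_dep_insert hiT hcirc.1 (A.not_dep_of_subset_indep hS.1 hT)
    have hTU : A.flag 1 S p ≤ A.inter T := by
      refine A.inter_anti fun k hk => Finset.mem_filter.mpr ⟨hT hk, ?_⟩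
      rw [hp]
      exact T.min'_le k hk
    have h := (hmin p).2 i (A.mem_sub.mpr (hTU.trans hle))
    rw [hp] at h
    exact absurd h (not_le.mpr (hlt _ (T.min'_mem hTne)))
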